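/- Let K be a field of characteristic different from 2 and let a, b be nonzero elements of K. Then the tensor product ℍ[K,a,b] ⊗_K ℍ[K,a,b] of the quaternion algebra with itself over K is isomorphic as a K-algebra to the algebra of 4×4 matrices over K. (The class of a quaternion algebra in the Brauer group is 2-torsion.) -/

import Mathlib

open Quaternion TensorProduct

namespace QuaternionAlgebra

/-- Every element of `ℍ[K,a,b] ⊗[K] M` is a combination of `1`, `i`, `j`, `k` with coefficients
in `M`. -/
theorem exists_eq_tmul_add_tmul {K M : Type*} [CommRing K] [AddCommGroup M] [Module K M]
    {a b : K} (x : ℍ[K, a, b] ⊗[K] M) :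
    ∃ m n p q : M, x = (⟨1, 0, 0, 0⟩ : ℍ[K, a, b]) ⊗ₜ[K] m + (⟨0, 1, 0, 0⟩ : ℍ[K, a, b]) ⊗ₜ[K] n +
      (⟨0, 0, 1, 0⟩ : ℍ[K, a, b]) ⊗ₜ[K] p + (⟨0, 0, 0, 1⟩ : ℍ[K, a, b]) ⊗ₜ[K] q := by
  induction x with
  | zero => exact ⟨0, 0, 0, 0, by simp⟩
  | tmul u v =>
    refine ⟨u.re • v, u.imI • v, u.imJ • v, u.imK • v, ?_⟩
    simp only [← TensorProduct.smul_tmul, ← TensorProduct.add_tmul]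
    congr 1
    ext <;> simp
  | add x y hx hy =>
    obtain ⟨m, n, p, q, rfl⟩ := hx
    obtain ⟨m', n', p', q', rfl⟩ := hy
    refine ⟨m + m', n + n', p + p', q + q', ?_⟩
    simp only [TensorProduct.tmul_add]
    abel

/-- If `z ↦ z m + i z n + j z p + k z q` vanishes on the standard basis of a nondegenerate
quaternion algebra, then all four coefficients vanish. -/
theorem eq_zero_of_forall_mul_mul_eq_zero {K : Type*} [Field K] (h2 : (2 : K) ≠ 0) {a b : K}
    (ha : a ≠ 0) (hb : b ≠ 0) {m n p q : ℍ[K, a, b]}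
    (h : ∀ z : ℍ[K, a, b], (⟨1, 0, 0, 0⟩ : ℍ[K, a, b]) * z * m + ⟨0, 1, 0, 0⟩ * z * n +
      ⟨0, 0, 1, 0⟩ * z * p + ⟨0, 0, 0, 1⟩ * z * q = 0) :
    m = 0 ∧ n = 0 ∧ p = 0 ∧ q = 0 := by
  have h0 := h ⟨1, 0, 0, 0⟩
  have h1 := h ⟨0, 1, 0, 0⟩
  have h3 := h ⟨0, 0, 1, 0⟩
  have h4 := h ⟨0, 0, 0, 1⟩
  simp only [QuaternionAlgebra.ext_iff, re_add, imI_add, imJ_add, imK_add, re_mul, imI_mul,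
    imJ_mul, imK_mul, re_zero, imI_zero, imJ_zero, imK_zero] at h0 h1 h3 h4 ⊢
  simp only [mul_zero, zero_mul, mul_one, one_mul, add_zero, zero_add, sub_zero, zero_sub] at *
  clear h
  have hc : (2 * 2 * (a * b) * (a * b) : K) ≠ 0 := by simp [h2, ha, hb]
  refine ⟨⟨?_, ?_, ?_, ?_⟩, ⟨?_, ?_, ?_, ?_⟩, ⟨?_, ?_, ?_, ?_⟩, ⟨?_, ?_, ?_, ?_⟩⟩ <;>
    refine (mul_eq_zero_iff_left hc).mp ?_ <;> grind

/-- The action `x ⊗ y ↦ (z ↦ x * z * star y)` of `ℍ[K,a,b] ⊗[K] ℍ[K,a,b]` on `ℍ[K,a,b]`. -/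
noncomputable def mulLeftStarRight (K : Type*) [CommRing K] (a b : K) :
    ℍ[K, a, b] ⊗[K] ℍ[K, a, b] →ₐ[K] Module.End K ℍ[K, a, b] :=
  (AlgHom.mulLeftRight K ℍ[K, a, b]).comp
    (Algebra.TensorProduct.map (AlgHom.id K ℍ[K, a, b]) (starAe (R := K)).toAlgHom)

theorem mulLeftStarRight_tmul_apply {K : Type*} [CommRing K] {a b : K} (x y z : ℍ[K, a, b]) :
    mulLeftStarRight K a b (x ⊗ₜ y) z = x * z * star y := by
  simp [mulLeftStarRight]

theorem mulLeftStarRight_injective {K : Type*} [Field K] (h2 : (2 : K) ≠ 0) {a b : K}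
    (ha : a ≠ 0) (hb : b ≠ 0) : Function.Injective (mulLeftStarRight K a b) := by
  rw [injective_iff_map_eq_zero]
  intro x hx
  obtain ⟨m, n, p, q, rfl⟩ := exists_eq_tmul_add_tmul x
  have h (z : ℍ[K, a, b]) := LinearMap.congr_fun hx z
  simp only [map_add, LinearMap.add_apply, mulLeftStarRight_tmul_apply,
    LinearMap.zero_apply] at h
  obtain ⟨hm, hn, hp, hq⟩ := eq_zero_of_forall_mul_mul_eq_zero h2 ha hb h
  rw [star_eq_zero] at hm hn hp hq
  simp [hm, hn, hp, hq]

theorem mulLeftStarRight_bijective {K : Type*} [Field K] (h2 : (2 : K) ≠ 0) {a b : K}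
    (ha : a ≠ 0) (hb : b ≠ 0) : Function.Bijective (mulLeftStarRight K a b) := by
  have hinj := mulLeftStarRight_injective h2 ha hb
  refine ⟨hinj, ?_⟩
  have hfin : Module.finrank K (ℍ[K, a, b] ⊗[K] ℍ[K, a, b]) =
      Module.finrank K (Module.End K ℍ[K, a, b]) := by
    rw [Module.finrank_tensorProduct, Module.finrank_linearMap]
  exact (LinearMap.injective_iff_surjective_of_finrank_eq_finrank
    (f := (mulLeftStarRight K a b).toLinearMap) hfin).mp hinj

end QuaternionAlgebra

/-- For a field `K` of characteristic ≠ 2 and nonzero `a, b : K`, the tensor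
product `ℍ[K,a,b] ⊗[K] ℍ[K,a,b]` is isomorphic as a `K`-algebra to the 4×4 matrix algebra
over `K`: quaternion classes are 2-torsion in the Brauer group. -/
theorem quaternionAlgebra_tensor_self_iso_matrix
    (K : Type*) [Field K] (hchar : ringChar K ≠ 2) (a b : K) (ha : a ≠ 0) (hb : b ≠ 0) :
    Nonempty ((ℍ[K, a, b] ⊗[K] ℍ[K, a, b]) ≃ₐ[K] Matrix (Fin 4) (Fin 4) K) :=
  ⟨(AlgEquiv.ofBijective (QuaternionAlgebra.mulLeftStarRight K a b)
      (QuaternionAlgebra.mulLeftStarRight_bijective (Ring.two_ne_zero hchar) ha hb)).trans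
    (algEquivMatrix (QuaternionAlgebra.basisOneIJK a 0 b))⟩
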